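/- For every integer n ≥ 1 there is a constant C > 0 such that for all real numbers A, B > 0 with A² ≤ B, all z ∈ ℝ^{2n} and all t ∈ ℝ: ∫_ℝ [A / (A² + |z|² + |t−u|)^{n + 3/2}] · [B / (B + |u|)²] du ≤ C · [A^{1/2} / (A + |z|)^{2n + 1/2}] · [B^{1/4} / (B + |t|)^{5/4}]. -/

import Mathlib

open MeasureTheory

/-- Scaling of the integral of a Japanese-bracket type weight on the line. -/
lemma integrable_and_integral_add_abs_rpow_neg {p D : ℝ} (hp : 1 < p) (hD : 0 < D) :
    Integrable (fun x : ℝ => (D + |x|) ^ (-p)) ∧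
      ∫ x : ℝ, (D + |x|) ^ (-p) = D ^ (1 - p) * ∫ x : ℝ, (1 + |x|) ^ (-p) := by
  have hint : Integrable (fun x : ℝ => (1 + |x|) ^ (-p)) := by
    simpa using integrable_one_add_norm (E := ℝ) (μ := volume) (r := p) (by simpa using hp)
  have hscale : (fun x : ℝ => (D + |x|) ^ (-p)) = fun x => D ^ (-p) * (1 + |x / D|) ^ (-p) := by
    funext x
    rw [← Real.mul_rpow hD.le (by positivity), abs_div, abs_of_pos hD]
    congr 1
    field_simp
  rw [hscale]
  refine ⟨(hint.comp_div hD.ne').const_mul _, ?_⟩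
  rw [integral_const_mul, Measure.integral_comp_div (fun x : ℝ => (1 + |x|) ^ (-p)), abs_of_pos hD,
    smul_eq_mul, ← mul_assoc, ← Real.rpow_add_one hD.ne', neg_add_eq_sub]

lemma div_sq_le_of_add_le {B S T : ℝ} (hB : 0 < B) (hS : 0 < S) (hBT : B ≤ T) (hTS : T ≤ 2 * S) :
    B / S ^ 2 ≤ 4 * (B ^ ((1 : ℝ) / 4) * T ^ (-(5 / 4) : ℝ)) := by
  have hT : 0 < T := hB.trans_le hBT
  have h1 : B / S ^ 2 ≤ 4 * (B / T ^ 2) := by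
    rw [mul_div_assoc', div_le_div_iff₀ (by positivity) (by positivity)]
    nlinarith [mul_le_mul_of_nonneg_left (pow_le_pow_left₀ hT.le hTS 2) hB.le]
  have h2 : B / T ^ 2 ≤ B ^ ((1 : ℝ) / 4) * T ^ (-(5 / 4) : ℝ) := by
    have hBsplit : B = B ^ ((1 : ℝ) / 4) * B ^ ((3 : ℝ) / 4) := by
      rw [← Real.rpow_add hB]; norm_num
    have hTsplit : T ^ ((3 : ℝ) / 4) = T ^ (-(5 / 4) : ℝ) * T ^ 2 := by
      rw [← Real.rpow_natCast, ← Real.rpow_add hT]; norm_num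
    rw [div_le_iff₀ (by positivity), mul_assoc, ← hTsplit]
    calc B = B ^ ((1 : ℝ) / 4) * B ^ ((3 : ℝ) / 4) := hBsplit
      _ ≤ _ := by gcongr
  linarith

lemma rpow_neg_le_of_le_two_mul {q D E S T : ℝ} (hq : 0 ≤ q) (hD : 0 < D) (hT : 0 < T)
    (hDE : D + S ≤ 2 * E) (hTS : T ≤ 2 * S) :
    E ^ (-(q + 3 / 2)) ≤
      2 ^ (q + 3 / 2) * 2 ^ ((5 : ℝ) / 4) * (T ^ (-(5 / 4) : ℝ) * D ^ (-(q + 1 / 4))) := by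
  have hS : 0 < S := by linarith
  have h1 : E ^ (-(q + 3 / 2)) ≤ ((D + S) / 2) ^ (-(q + 3 / 2)) :=
    Real.rpow_le_rpow_of_nonpos (by positivity) (by linarith) (by linarith)
  have h2 : ((D + S) / 2) ^ (-(q + 3 / 2)) = 2 ^ (q + 3 / 2) * (D + S) ^ (-(q + 3 / 2)) := by
    rw [Real.div_rpow (by positivity) (by norm_num), Real.rpow_neg (by norm_num : (0 : ℝ) ≤ 2),
      div_inv_eq_mul, mul_comm]
  have h3 : (D + S) ^ (-(q + 3 / 2)) =
      (D + S) ^ (-(5 / 4) : ℝ) * (D + S) ^ (-(q + 1 / 4)) := by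
    rw [← Real.rpow_add (by positivity)]; ring_nf
  have h4 : (D + S) ^ (-(5 / 4) : ℝ) ≤ (T / 2) ^ (-(5 / 4) : ℝ) :=
    Real.rpow_le_rpow_of_nonpos (by positivity) (by linarith) (by norm_num)
  have h5 : (T / 2) ^ (-(5 / 4) : ℝ) = 2 ^ ((5 : ℝ) / 4) * T ^ (-(5 / 4) : ℝ) := by
    rw [Real.div_rpow (by positivity) (by norm_num), Real.rpow_neg (by norm_num : (0 : ℝ) ≤ 2),
      div_inv_eq_mul, mul_comm]
  have h6 : (D + S) ^ (-(q + 1 / 4)) ≤ D ^ (-(q + 1 / 4)) :=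
    Real.rpow_le_rpow_of_nonpos (by positivity) (by linarith) (by linarith)
  calc E ^ (-(q + 3 / 2))
      ≤ 2 ^ (q + 3 / 2) * ((D + S) ^ (-(5 / 4) : ℝ) * (D + S) ^ (-(q + 1 / 4))) := by
        rw [← h3, ← h2]; exact h1
    _ ≤ 2 ^ (q + 3 / 2) * ((2 ^ ((5 : ℝ) / 4) * T ^ (-(5 / 4) : ℝ)) * D ^ (-(q + 1 / 4))) := by
        rw [← h5]; gcongr
    _ = _ := by ring

lemma self_le_rpow_mul_rpow {A B : ℝ} (hA : 0 < A) (hAB : A ^ 2 ≤ B) :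
    A ≤ A ^ ((1 : ℝ) / 2) * B ^ ((1 : ℝ) / 4) := by
  have h : A ^ ((1 : ℝ) / 2) ≤ B ^ ((1 : ℝ) / 4) := by
    calc A ^ ((1 : ℝ) / 2) = (A ^ 2) ^ ((1 : ℝ) / 4) := by
          rw [← Real.rpow_natCast, ← Real.rpow_mul hA.le]; norm_num
      _ ≤ _ := by gcongr
  calc A = A ^ ((1 : ℝ) / 2) * A ^ ((1 : ℝ) / 2) := by
        rw [← Real.rpow_add hA]; norm_num
    _ ≤ _ := by gcongr

/-- The product of the two weights is dominated by a sum of integrable weights: the first summand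
covers the region where `B + |u|` is comparable to `B + |t|`, the second its complement. -/
lemma weight_mul_weight_le {q A B D : ℝ} (hq : 0 ≤ q) (hA : 0 < A) (hB : 0 < B) (hD : 0 < D)
    (hAB : A ^ 2 ≤ B) (t u : ℝ) :
    A / (D + |t - u|) ^ (q + 3 / 2) * (B / (B + |u|) ^ 2) ≤
      4 * (A * (B ^ ((1 : ℝ) / 4) * (B + |t|) ^ (-(5 / 4) : ℝ))) *
          (D + |t - u|) ^ (-(q + 3 / 2)) +
        2 ^ (q + 3 / 2) * 2 ^ ((5 : ℝ) / 4) *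
            (A ^ ((1 : ℝ) / 2) * B ^ ((1 : ℝ) / 4) *
              ((B + |t|) ^ (-(5 / 4) : ℝ) * D ^ (-(q + 1 / 4)))) *
          (B * (B + |u|) ^ (-2 : ℝ)) := by
  have hE : 0 < D + |t - u| := by positivity
  have hS : 0 < B + |u| := by positivity
  have hT : 0 < B + |t| := by positivity
  have hpow : B * (B + |u|) ^ (-2 : ℝ) = B / (B + |u|) ^ 2 := by
    rw [Real.rpow_neg hS.le, div_eq_mul_inv]; norm_num
  have hdiv : A / (D + |t - u|) ^ (q + 3 / 2) = A * (D + |t - u|) ^ (-(q + 3 / 2)) := by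
    rw [Real.rpow_neg hE.le, div_eq_mul_inv]
  rw [hpow, hdiv]
  by_cases h : B + |t| ≤ 2 * (B + |u|)
  · refine le_add_of_le_of_nonneg ?_ (by positivity)
    have := div_sq_le_of_add_le hB hS (by linarith [abs_nonneg t]) h
    calc _ ≤ A * (D + |t - u|) ^ (-(q + 3 / 2)) *
          (4 * (B ^ ((1 : ℝ) / 4) * (B + |t|) ^ (-(5 / 4) : ℝ))) := by gcongr
      _ = _ := by ring
  · push Not at h
    refine le_add_of_nonneg_of_le (by positivity) ?_
    have htri : |t| - |u| ≤ |t - u| := abs_sub_abs_le_abs_sub t u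
    have := rpow_neg_le_of_le_two_mul (S := |t|) hq hD hT (E := D + |t - u|)
      (by linarith) (by linarith [abs_nonneg u])
    have hA' := self_le_rpow_mul_rpow hA hAB
    calc _ ≤ (A ^ ((1 : ℝ) / 2) * B ^ ((1 : ℝ) / 4)) *
          (2 ^ (q + 3 / 2) * 2 ^ ((5 : ℝ) / 4) *
            ((B + |t|) ^ (-(5 / 4) : ℝ) * D ^ (-(q + 1 / 4)))) * (B / (B + |u|) ^ 2) := by gcongr
      _ = _ := by ring

lemma integral_weight_mul_weight_le {q A B D : ℝ} (hq : 0 ≤ q) (hA : 0 < A) (hB : 0 < B)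
    (hAD : A ^ 2 ≤ D) (hAB : A ^ 2 ≤ B) (t : ℝ) :
    ∫ u : ℝ, A / (D + |t - u|) ^ (q + 3 / 2) * (B / (B + |u|) ^ 2) ≤
      (4 * (∫ x : ℝ, (1 + |x|) ^ (-(q + 3 / 2))) +
          2 ^ (q + 3 / 2) * 2 ^ ((5 : ℝ) / 4) * ∫ x : ℝ, (1 + |x|) ^ (-2 : ℝ)) *
        (A ^ ((1 : ℝ) / 2) * D ^ (-(q + 1 / 4)) *
          (B ^ ((1 : ℝ) / 4) * (B + |t|) ^ (-(5 / 4) : ℝ))) := by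
  have hD : 0 < D := lt_of_lt_of_le (by positivity) hAD
  obtain ⟨hi₁, he₁⟩ := integrable_and_integral_add_abs_rpow_neg (p := q + 3 / 2) (by linarith) hD
  obtain ⟨hi₂, he₂⟩ := integrable_and_integral_add_abs_rpow_neg (p := 2) (by norm_num) hB
  have hi₁' : Integrable fun u : ℝ => (D + |t - u|) ^ (-(q + 3 / 2)) := hi₁.comp_sub_left t
  have he₁' := integral_sub_left_eq_self (fun x : ℝ => (D + |x|) ^ (-(q + 3 / 2))) volume t
  have hpos₁ : 0 ≤ ∫ x : ℝ, (1 + |x|) ^ (-(q + 3 / 2)) :=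
    integral_nonneg fun x => by positivity
  refine (integral_mono_of_nonneg (Filter.Eventually.of_forall fun u => by positivity)
    ((hi₁'.const_mul _).add ((hi₂.const_mul B).const_mul _))
    (Filter.Eventually.of_forall fun u => weight_mul_weight_le hq hA hB hD hAB t u)).trans ?_
  simp only [Pi.add_apply]
  rw [integral_add (hi₁'.const_mul _) ((hi₂.const_mul B).const_mul _), integral_const_mul,
    integral_const_mul, integral_const_mul, he₁', he₁, he₂]
  have hBB : B * (B ^ ((1 : ℝ) - 2) * ∫ x : ℝ, (1 + |x|) ^ (-2 : ℝ)) =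
      ∫ x : ℝ, (1 + |x|) ^ (-2 : ℝ) := by
    rw [← mul_assoc, show (1 : ℝ) - 2 = -1 by norm_num, Real.rpow_neg_one,
      mul_inv_cancel₀ hB.ne', one_mul]
  have hAD' : A * D ^ (1 - (q + 3 / 2)) ≤ A ^ ((1 : ℝ) / 2) * D ^ (-(q + 1 / 4)) := by
    calc A * D ^ (1 - (q + 3 / 2))
        ≤ A ^ ((1 : ℝ) / 2) * D ^ ((1 : ℝ) / 4) * D ^ (1 - (q + 3 / 2)) := by
          gcongr; exact self_le_rpow_mul_rpow hA hAD
      _ = _ := by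
          rw [mul_assoc, ← Real.rpow_add hD]; ring_nf
  rw [hBB]
  calc _ = 4 * ((B ^ ((1 : ℝ) / 4) * (B + |t|) ^ (-(5 / 4) : ℝ))) *
          (∫ x : ℝ, (1 + |x|) ^ (-(q + 3 / 2))) * (A * D ^ (1 - (q + 3 / 2))) + _ := by
        congr 1; ring
    _ ≤ 4 * ((B ^ ((1 : ℝ) / 4) * (B + |t|) ^ (-(5 / 4) : ℝ))) *
          (∫ x : ℝ, (1 + |x|) ^ (-(q + 3 / 2))) *
            (A ^ ((1 : ℝ) / 2) * D ^ (-(q + 1 / 4))) + _ := by gcongr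
    _ = _ := by ring

lemma sq_add_sq_rpow_neg_le {q A r : ℝ} (hq : 0 ≤ q) (hA : 0 < A) (hr : 0 ≤ r) :
    (A ^ 2 + r ^ 2) ^ (-(q + 1 / 4)) ≤
      2 ^ (q + 1 / 4) * ((A + r) ^ (2 * q + 1 / 2))⁻¹ := by
  have hs : 0 < A + r := by positivity
  have h1 : (A + r) ^ (2 * q + 1 / 2) = ((A + r) ^ 2) ^ (q + 1 / 4) := by
    rw [← Real.rpow_natCast, ← Real.rpow_mul hs.le]; push_cast; ring_nf
  rw [h1, Real.rpow_neg (by positivity), ← div_eq_mul_inv, inv_eq_one_div,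
    div_le_div_iff₀ (by positivity) (by positivity), one_mul,
    ← Real.mul_rpow (by norm_num) (by positivity)]
  exact Real.rpow_le_rpow (by positivity) (by nlinarith [sq_nonneg (A - r)]) (by linarith)

theorem stmt13 (n : ℕ) (hn : 1 ≤ n) :
    ∃ C : ℝ, 0 < C ∧
      ∀ A B : ℝ, 0 < A → 0 < B → A ^ 2 ≤ B →
        ∀ (z : EuclideanSpace ℝ (Fin (2 * n))) (t : ℝ),
          (∫ u : ℝ,
              (A / (A ^ 2 + ‖z‖ ^ 2 + |t - u|) ^ ((n : ℝ) + 3 / 2)) *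
                (B / (B + |u|) ^ 2)) ≤
            C * (A ^ ((1 : ℝ) / 2) / (A + ‖z‖) ^ (2 * (n : ℝ) + 1 / 2)) *
              (B ^ ((1 : ℝ) / 4) / (B + |t|) ^ ((5 : ℝ) / 4)) := by
  set K : ℝ := 4 * (∫ x : ℝ, (1 + |x|) ^ (-((n : ℝ) + 3 / 2))) +
    2 ^ ((n : ℝ) + 3 / 2) * 2 ^ ((5 : ℝ) / 4) * ∫ x : ℝ, (1 + |x|) ^ (-2 : ℝ) with hK
  have hq : (0 : ℝ) ≤ n := n.cast_nonneg
  have hK0 : 0 ≤ K := by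
    have h₁ : 0 ≤ ∫ x : ℝ, (1 + |x|) ^ (-((n : ℝ) + 3 / 2)) :=
      integral_nonneg fun x => by positivity
    have h₂ : 0 ≤ ∫ x : ℝ, (1 + |x|) ^ (-2 : ℝ) := integral_nonneg fun x => by positivity
    positivity
  refine ⟨(K + 1) * 2 ^ ((n : ℝ) + 1 / 4), by positivity, fun A B hA hB hAB z t => ?_⟩
  have hT : 0 < B + |t| := by positivity
  calc _ ≤ K * (A ^ ((1 : ℝ) / 2) * (A ^ 2 + ‖z‖ ^ 2) ^ (-((n : ℝ) + 1 / 4)) *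
          (B ^ ((1 : ℝ) / 4) * (B + |t|) ^ (-(5 / 4) : ℝ))) :=
        integral_weight_mul_weight_le hq hA hB (by nlinarith [sq_nonneg ‖z‖]) hAB t
    _ ≤ (K + 1) * (A ^ ((1 : ℝ) / 2) *
          (2 ^ ((n : ℝ) + 1 / 4) * ((A + ‖z‖) ^ (2 * (n : ℝ) + 1 / 2))⁻¹) *
          (B ^ ((1 : ℝ) / 4) * (B + |t|) ^ (-(5 / 4) : ℝ))) := by
        gcongr
        · linarith
        · exact sq_add_sq_rpow_neg_le hq hA (norm_nonneg z)
    _ = _ := by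
        rw [Real.rpow_neg hT.le]
        simp only [div_eq_mul_inv]
        ring
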